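/- arXiv:1005.0101 — 2 statements merged into one kernel-verified Lean document; each statement's English description precedes it below -/
import Mathlib

section
/- Let {T^α}_{α∈I} be a family of set-valued maps [t₀,θ₀]×ℝⁿ → 𝒫(ℝ²), each satisfying condition (N3). Define T(t,x) := ⋃_{α∈I} T^α(t,x) and let T* := Cl T be its graph-closure, i.e. [Cl T](t,x) := {(J₁,J₂) : there exist sequences (tᵏ,xᵏ) → (t,x) in [t₀,θ₀]×ℝⁿ and (z₁ᵏ,z₂ᵏ) → (J₁,J₂) with (z₁ᵏ,z₂ᵏ) ∈ T(tᵏ,xᵏ) for all k}. Then T* has closed graph and satisfies condition (N3). -/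
open Set Filter MeasureTheory
open scoped Topology

noncomputable section

/-- `F(t,x)` : the convex hull of the set of velocities `f(t,x,u,v)`, `u ∈ P`, `v ∈ Q`. -/
def velSet {n p q : ℕ}
    (f : ℝ → EuclideanSpace ℝ (Fin n) → EuclideanSpace ℝ (Fin p) → EuclideanSpace ℝ (Fin q) →
      EuclideanSpace ℝ (Fin n))
    (P : Set (EuclideanSpace ℝ (Fin p))) (Q : Set (EuclideanSpace ℝ (Fin q)))
    (t : ℝ) (x : EuclideanSpace ℝ (Fin n)) : Set (EuclideanSpace ℝ (Fin n)) :=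
  convexHull ℝ {z | ∃ u ∈ P, ∃ v ∈ Q, z = f t x u v}

/-- `y ∈ Sol(t*,x*)`. -/
def IsSol {n : ℕ} (F : ℝ → EuclideanSpace ℝ (Fin n) → Set (EuclideanSpace ℝ (Fin n)))
    (θ₀ tstar : ℝ) (xstar : EuclideanSpace ℝ (Fin n)) (y : ℝ → EuclideanSpace ℝ (Fin n)) : Prop :=
  (∃ K : NNReal, LipschitzOnWith K y (Icc tstar θ₀)) ∧ y tstar = xstar ∧
    ∀ᵐ t ∂(volume.restrict (Icc tstar θ₀)), ∃ v ∈ F t (y t), HasDerivAt y v t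

/-- Condition (N3). -/
def CondN3 {n : ℕ} (t₀ θ₀ : ℝ)
    (F : ℝ → EuclideanSpace ℝ (Fin n) → Set (EuclideanSpace ℝ (Fin n)))
    (T : ℝ → EuclideanSpace ℝ (Fin n) → Set (ℝ × ℝ)) : Prop :=
  ∀ tstar ∈ Icc t₀ θ₀, ∀ xstar : EuclideanSpace ℝ (Fin n), ∀ J ∈ T tstar xstar,
    ∃ y : ℝ → EuclideanSpace ℝ (Fin n), IsSol F θ₀ tstar xstar y ∧
      ∀ t ∈ Icc tstar θ₀, J ∈ T t (y t)

/-- The graph-closure `Cl T` of a multivalued map defined on `[t₀,θ₀]×ℝⁿ`: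
`(J₁,J₂) ∈ [Cl T](t,x)` iff there exist sequences `(tᵏ,xᵏ) → (t,x)` with `tᵏ ∈ [t₀,θ₀]`
and `(z₁ᵏ,z₂ᵏ) → (J₁,J₂)` with `(z₁ᵏ,z₂ᵏ) ∈ T(tᵏ,xᵏ)`. -/
def graphClosure {n : ℕ} (t₀ θ₀ : ℝ)
    (T : ℝ → EuclideanSpace ℝ (Fin n) → Set (ℝ × ℝ)) :
    ℝ → EuclideanSpace ℝ (Fin n) → Set (ℝ × ℝ) := fun t x =>
  {J | ∃ (ts : ℕ → ℝ) (xs : ℕ → EuclideanSpace ℝ (Fin n)) (zs : ℕ → ℝ × ℝ),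
    (∀ k, ts k ∈ Icc t₀ θ₀) ∧ (∀ k, zs k ∈ T (ts k) (xs k)) ∧
    Tendsto ts atTop (𝓝 t) ∧ Tendsto xs atTop (𝓝 x) ∧ Tendsto zs atTop (𝓝 J)}

/-- In finite dimension the convex hull of a compact set is compact. -/
lemma IsCompact.isCompact_convexHull_of_finiteDimensional {E : Type*} [NormedAddCommGroup E]
    [NormedSpace ℝ E] [FiniteDimensional ℝ E] {K : Set E} (hK : IsCompact K) :
    IsCompact (convexHull ℝ K) := by
  rcases K.eq_empty_or_nonempty with rfl | ⟨k₀, hk₀⟩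
  · simp
  set d := Module.finrank ℝ E with hd
  have himage : convexHull ℝ K =
      (fun wz : (Fin (d + 1) → ℝ) × (Fin (d + 1) → E) => ∑ i, wz.1 i • wz.2 i) ''
        (stdSimplex ℝ (Fin (d + 1)) ×ˢ Set.univ.pi fun _ => K) := by
    apply Subset.antisymm
    · intro x hx
      obtain ⟨ι, _, z, w, hz, hind, hw, hw1, rfl⟩ := eq_pos_convex_span_of_mem_convexHull hx
      have hcard : Fintype.card ι ≤ Fintype.card (Fin (d + 1)) := by
        rw [Fintype.card_fin]
        exact hind.card_le_finrank_succ.trans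
          (Nat.succ_le_succ (Submodule.finrank_le _))
      obtain ⟨e⟩ := Function.Embedding.nonempty_of_card_le hcard
      refine ⟨(Function.extend e w 0, Function.extend e z fun _ => k₀), ⟨⟨fun j => ?_, ?_⟩, ?_⟩, ?_⟩
      · by_cases hj : ∃ i, e i = j
        · obtain ⟨i, rfl⟩ := hj
          simpa [e.injective.extend_apply] using (hw i).le
        · simp [Function.extend_apply' _ _ _ hj]
      · rw [← hw1]
        symm
        refine Fintype.sum_of_injective e e.injective _ _ (fun j hj => ?_) fun i => ?_
        · exact Function.extend_apply' _ _ _ hj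
        · exact (e.injective.extend_apply _ _ _).symm
      · intro j _
        by_cases hj : ∃ i, e i = j
        · obtain ⟨i, rfl⟩ := hj
          simpa [e.injective.extend_apply] using hz (mem_range_self i)
        · simpa [Function.extend_apply' _ _ _ hj] using hk₀
      · symm
        refine Fintype.sum_of_injective e e.injective _ _ (fun j hj => ?_) fun i => ?_
        · simp [Function.extend_apply' w _ _ hj]
        · simp [e.injective.extend_apply]
    · rintro _ ⟨⟨w, z⟩, ⟨hw, hz⟩, rfl⟩
      exact (convex_convexHull ℝ K).sum_mem (fun i _ => hw.1 i) hw.2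
        fun i _ => subset_convexHull ℝ K (hz i (mem_univ i))
  rw [himage]
  refine ((isCompact_stdSimplex ℝ (Fin (d + 1))).prod (isCompact_univ_pi fun _ => hK)).image ?_
  fun_prop

/-- A Lipschitz function whose derivative is almost everywhere at most `c` grows at rate at
most `c`. -/
lemma sub_le_of_ae_hasDerivAt_le {g : ℝ → ℝ} {a b c : ℝ} {K : NNReal} (hab : a ≤ b)
    (hg : LipschitzOnWith K g (Icc a b))
    (h : ∀ᵐ t ∂(volume.restrict (Icc a b)), ∃ v ≤ c, HasDerivAt g v t) :
    g b - g a ≤ c * (b - a) := by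
  have hac : AbsolutelyContinuousOnInterval g a b :=
    LipschitzOnWith.absolutelyContinuousOnInterval (by rwa [uIcc_of_le hab])
  rw [← hac.integral_deriv_eq_sub]
  have hle : ∫ t in a..b, deriv g t ≤ ∫ _ in a..b, c := by
    refine intervalIntegral.integral_mono_ae_restrict hab hac.intervalIntegrable_deriv
      intervalIntegrable_const ?_
    filter_upwards [h] with t ⟨v, hv, hd⟩
    simpa [hd.deriv] using hv
  refine hle.trans_eq ?_
  simp [mul_comm]

/-- A Lipschitz curve whose velocity has norm at most `M` almost everywhere moves at speed at
most `M`. -/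
lemma norm_sub_le_of_ae_hasDerivAt {E : Type*} [NormedAddCommGroup E] [InnerProductSpace ℝ E]
    {y : ℝ → E} {a b M : ℝ} {K : NNReal} (hab : a ≤ b) (hy : LipschitzOnWith K y (Icc a b))
    (h : ∀ᵐ t ∂(volume.restrict (Icc a b)), ∃ v, ‖v‖ ≤ M ∧ HasDerivAt y v t) :
    ‖y b - y a‖ ≤ M * (b - a) := by
  rcases eq_or_ne (y b - y a) 0 with h0 | h0
  · rcases hab.eq_or_lt with rfl | hlt
    · simp
    have hne : volume.restrict (Icc a b) ≠ 0 := by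
      simp [Measure.restrict_eq_zero, hlt]
    have : NeBot (ae (volume.restrict (Icc a b))) := ae_neBot.2 hne
    obtain ⟨t, v, hv, -⟩ := h.exists
    rw [h0, norm_zero]
    exact mul_nonneg ((norm_nonneg v).trans hv) (sub_nonneg.2 hab)
  · set w := y b - y a with hw
    have hlip : LipschitzOnWith (‖innerSL ℝ w‖₊ * K) (fun t => innerSL ℝ w (y t)) (Icc a b) :=
      (innerSL ℝ w).lipschitz.comp_lipschitzOnWith hy
    have key := sub_le_of_ae_hasDerivAt_le (c := ‖w‖ * M) hab hlip (by
      filter_upwards [h] with t ⟨v, hv, hd⟩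
      refine ⟨innerSL ℝ w v, ?_, (innerSL ℝ w).hasFDerivAt.comp_hasDerivAt t hd⟩
      rw [innerSL_apply_apply]
      exact (real_inner_le_norm w v).trans (by gcongr))
    rw [← map_sub, ← hw, innerSL_apply_apply, real_inner_self_eq_norm_sq] at key
    have hpos : 0 < ‖w‖ := norm_pos_iff.2 h0
    nlinarith

lemma lipschitzWith_log_one_add_sq : LipschitzWith 1 fun r : ℝ => Real.log (1 + r ^ 2) := by
  have hd : ∀ r : ℝ, HasDerivAt (fun r : ℝ => Real.log (1 + r ^ 2)) (2 * r / (1 + r ^ 2)) r := by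
    intro r
    have h1 : HasDerivAt (fun r : ℝ => 1 + r ^ 2) (2 * r) r := by
      simpa using (hasDerivAt_pow 2 r).const_add 1
    exact h1.log (by positivity)
  refine lipschitzWith_of_nnnorm_deriv_le (fun r => (hd r).differentiableAt) fun r => ?_
  rw [(hd r).deriv, ← NNReal.coe_le_coe, coe_nnnorm, Real.norm_eq_abs, abs_div,
    abs_of_pos (by positivity : (0 : ℝ) < 1 + r ^ 2), NNReal.coe_one, div_le_one (by positivity),
    abs_le]
  constructor <;> nlinarith [sq_nonneg (r + 1), sq_nonneg (r - 1)]

/-- A priori bound for Lipschitz curves whose velocity has at most linear growth. -/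
lemma norm_le_of_ae_hasDerivAt_growth {E : Type*} [NormedAddCommGroup E] [InnerProductSpace ℝ E]
    {y : ℝ → E} {a b C : ℝ} {K : NNReal} (hC : 0 ≤ C) (hab : a ≤ b)
    (hy : LipschitzOnWith K y (Icc a b))
    (h : ∀ᵐ t ∂(volume.restrict (Icc a b)), ∃ v, ‖v‖ ≤ C * (1 + ‖y t‖) ∧ HasDerivAt y v t) :
    ‖y b‖ ≤ (1 + ‖y a‖ ^ 2) * Real.exp (4 * C * (b - a)) := by
  have hlip : LipschitzOnWith (1 * (1 * K)) (fun t => Real.log (1 + ‖y t‖ ^ 2)) (Icc a b) :=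
    lipschitzWith_log_one_add_sq.comp_lipschitzOnWith (lipschitzWith_one_norm.comp_lipschitzOnWith hy)
  have key := sub_le_of_ae_hasDerivAt_le (c := 4 * C) hab hlip (by
    filter_upwards [h] with t ⟨v, hv, hd⟩
    refine ⟨_, ?_, (hd.norm_sq.const_add 1).log (by positivity)⟩
    rw [div_le_iff₀ (by positivity)]
    have h1 : inner ℝ (y t) v ≤ ‖y t‖ * (C * (1 + ‖y t‖)) :=
      (real_inner_le_norm _ _).trans (by gcongr)
    nlinarith [mul_nonneg hC (sq_nonneg (‖y t‖ - 1)), mul_nonneg hC (sq_nonneg ‖y t‖)])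
  have hlog : Real.log (1 + ‖y b‖ ^ 2) ≤ Real.log (1 + ‖y a‖ ^ 2) + 4 * C * (b - a) := by
    linarith
  have hexp := Real.exp_le_exp.2 hlog
  rw [Real.exp_add, Real.exp_log (by positivity), Real.exp_log (by positivity)] at hexp
  nlinarith [sq_nonneg (‖y b‖ - 1), norm_nonneg (y b)]

/-- Upper semicontinuity of a multivalued map on `[t₀,θ₀]×E`, tested on linear functionals. -/
def ScalarUpperSemicontinuous {E : Type*} [NormedAddCommGroup E] [NormedSpace ℝ E] (t₀ θ₀ : ℝ)
    (F : ℝ → E → Set E) : Prop :=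
  ∀ t ∈ Icc t₀ θ₀, ∀ x : E, ∀ (l : StrongDual ℝ E) (c : ℝ), (∀ v ∈ F t x, l v ≤ c) →
    ∀ ε > 0, ∃ δ > 0, ∀ s ∈ Icc t₀ θ₀, ∀ x' : E, dist s t < δ → dist x' x < δ →
      ∀ v ∈ F s x', l v ≤ c + ε

/-- The velocity of a pointwise limit of equi-Lipschitz solutions belongs to the right-hand
side. -/
lemma ScalarUpperSemicontinuous.mem_of_hasDerivAt_limit {E ι : Type*} [NormedAddCommGroup E]
    [NormedSpace ℝ E] {t₀ θ₀ : ℝ} {F : ℝ → E → Set E} (hF : ScalarUpperSemicontinuous t₀ θ₀ F)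
    {U : Filter ι} [NeBot U] {Y : ι → ℝ → E} {y : ℝ → E} {M : NNReal}
    (hY : ∀ k, LipschitzWith M (Y k)) (hlim : ∀ s, Tendsto (fun k => Y k s) U (𝓝 (y s)))
    {t : ℝ} (ht : t ∈ Ico t₀ θ₀) (hclosed : IsClosed (F t (y t))) (hconv : Convex ℝ (F t (y t)))
    (hsol : ∀ᶠ k in U, ∀ᵐ s ∂(volume.restrict (Icc t θ₀)),
      ∃ w ∈ F s (Y k s), HasDerivAt (Y k) w s)
    {v : E} (hv : HasDerivAt y v t) : v ∈ F t (y t) := by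
  by_contra hnot
  obtain ⟨l, c, hlc, hcv⟩ := geometric_hahn_banach_closed_point hconv hclosed hnot
  set ε := (l v - c) / 2 with hε
  have hεpos : 0 < ε := by rw [hε]; linarith
  obtain ⟨δ, hδ, hnear⟩ :=
    hF t ⟨ht.1, ht.2.le⟩ (y t) l c (fun w hw => (hlc w hw).le) ε hεpos
  have hgrowth : ∀ b, t < b → b < θ₀ → b - t < δ → M * (b - t) < δ / 2 →
      l (y b) - l (y t) ≤ (c + ε) * (b - t) := by
    intro b htb hbθ hbδ hMb
    refine le_of_tendsto
      (((l.continuous.tendsto _).comp (hlim b)).sub ((l.continuous.tendsto _).comp (hlim t))) ?_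
    filter_upwards [hsol, (hlim t).eventually (Metric.ball_mem_nhds _ (half_pos hδ))] with k hk hkt
    refine sub_le_of_ae_hasDerivAt_le (g := fun s => l (Y k s)) htb.le
      ((l.lipschitz.comp (hY k)).lipschitzOnWith) ?_
    have hk' := ae_restrict_of_ae_restrict_of_subset (Icc_subset_Icc_right hbθ.le) hk
    filter_upwards [hk', ae_restrict_mem measurableSet_Icc] with s ⟨w, hw, hd⟩ hs
    refine ⟨l w, ?_, l.hasFDerivAt.comp_hasDerivAt s hd⟩
    have hdist : dist s t = s - t := by
      rw [Real.dist_eq, abs_of_nonneg (sub_nonneg.2 hs.1)]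
    refine hnear s ⟨ht.1.trans hs.1, hs.2.trans hbθ.le⟩ (Y k s) ?_ ?_ w hw
    · rw [hdist]; linarith [hs.2]
    · have h1 := (hY k).dist_le_mul s t
      rw [hdist] at h1
      have h2 : (M : ℝ) * (s - t) ≤ M * (b - t) := by gcongr; exact hs.2
      have h3 := dist_triangle (Y k s) (Y k t) (y t)
      have h4 : dist (Y k t) (y t) < δ / 2 := hkt
      linarith
  have hslope : Tendsto (slope (fun s => l (y s)) t) (𝓝[>] t) (𝓝 (l v)) :=
    (hasDerivWithinAt_iff_tendsto_slope' (by simp)).1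
      (l.hasFDerivAt.comp_hasDerivAt t hv).hasDerivWithinAt
  have hle : l v ≤ c + ε := by
    refine le_of_tendsto hslope ?_
    have e1 : ∀ᶠ b in 𝓝[>] t, b < θ₀ := nhdsWithin_le_nhds (Iio_mem_nhds ht.2)
    have e2 : ∀ᶠ b in 𝓝[>] t, b - t < δ := by
      refine nhdsWithin_le_nhds ?_
      have hcont : Continuous fun b : ℝ => b - t := by fun_prop
      exact hcont.continuousAt.eventually_lt continuousAt_const (by simpa using hδ)
    have e3 : ∀ᶠ b in 𝓝[>] t, M * (b - t) < δ / 2 := by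
      refine nhdsWithin_le_nhds ?_
      have hcont : Continuous fun b : ℝ => M * (b - t) := by fun_prop
      exact hcont.continuousAt.eventually_lt continuousAt_const (by simpa using hδ)
    filter_upwards [e1, e2, e3, self_mem_nhdsWithin] with b h1 h2 h3 h4
    rw [slope_def_field, div_le_iff₀ (sub_pos.2 h4)]
    exact hgrowth b h4 h1 h2 h3
  rw [hε] at hle
  linarith

section velSet

variable {n p q : ℕ} {t₀ θ₀ : ℝ} {P : Set (EuclideanSpace ℝ (Fin p))}
  {Q : Set (EuclideanSpace ℝ (Fin q))}
  {f : ℝ → EuclideanSpace ℝ (Fin n) → EuclideanSpace ℝ (Fin p) → EuclideanSpace ℝ (Fin q) →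
    EuclideanSpace ℝ (Fin n)}

lemma isClosed_velSet (hPc : IsCompact P) (hQc : IsCompact Q)
    (hf_cont : ContinuousOn
      (fun z : ℝ × EuclideanSpace ℝ (Fin n) × EuclideanSpace ℝ (Fin p) × EuclideanSpace ℝ (Fin q) =>
        f z.1 z.2.1 z.2.2.1 z.2.2.2)
      (Icc t₀ θ₀ ×ˢ (univ : Set (EuclideanSpace ℝ (Fin n))) ×ˢ P ×ˢ Q))
    {t : ℝ} (ht : t ∈ Icc t₀ θ₀) (x : EuclideanSpace ℝ (Fin n)) :
    IsClosed (velSet f P Q t x) := by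
  refine IsCompact.isClosed (IsCompact.isCompact_convexHull_of_finiteDimensional ?_)
  have himage : {z | ∃ u ∈ P, ∃ v ∈ Q, z = f t x u v} = (fun w => f t x w.1 w.2) '' (P ×ˢ Q) := by
    ext z
    constructor
    · rintro ⟨u, hu, v, hv, rfl⟩
      exact ⟨(u, v), ⟨hu, hv⟩, rfl⟩
    · rintro ⟨⟨u, v⟩, ⟨hu, hv⟩, rfl⟩
      exact ⟨u, hu, v, hv, rfl⟩
  rw [himage]
  refine (hPc.prod hQc).image_of_continuousOn ?_
  exact hf_cont.comp (f := fun w : EuclideanSpace ℝ (Fin p) × EuclideanSpace ℝ (Fin q) =>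
    (t, x, w.1, w.2)) (by fun_prop) fun w hw => ⟨ht, mem_univ _, hw.1, hw.2⟩

lemma scalarUpperSemicontinuous_velSet (hPc : IsCompact P) (hQc : IsCompact Q)
    (hf_cont : ContinuousOn
      (fun z : ℝ × EuclideanSpace ℝ (Fin n) × EuclideanSpace ℝ (Fin p) × EuclideanSpace ℝ (Fin q) =>
        f z.1 z.2.1 z.2.2.1 z.2.2.2)
      (Icc t₀ θ₀ ×ˢ (univ : Set (EuclideanSpace ℝ (Fin n))) ×ˢ P ×ˢ Q)) :
    ScalarUpperSemicontinuous t₀ θ₀ (velSet f P Q) := by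
  intro t ht x l c hl ε hε
  have hcompact : IsCompact (Icc t₀ θ₀ ×ˢ Metric.closedBall x 1 ×ˢ P ×ˢ Q) :=
    isCompact_Icc.prod ((isCompact_closedBall x 1).prod (hPc.prod hQc))
  have huc := hcompact.uniformContinuousOn_of_continuous
    (l.continuous.comp_continuousOn (hf_cont.mono
      (prod_mono_right (prod_mono_left (subset_univ _)))))
  obtain ⟨δ, hδ, hnear⟩ := Metric.uniformContinuousOn_iff.1 huc ε hε
  refine ⟨min δ 1, by positivity, fun s hs x' hst hx v hv => ?_⟩
  have hhalf : Convex ℝ {w : EuclideanSpace ℝ (Fin n) | l w ≤ c + ε} :=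
    convex_halfSpace_le l.toLinearMap.isLinear _
  refine convexHull_min ?_ hhalf hv
  rintro _ ⟨a, ha, b, hb, rfl⟩
  have h1 := hnear (s, x', a, b)
    ⟨hs, Metric.mem_closedBall.2 (hx.le.trans (min_le_right _ _)), ha, hb⟩
    (t, x, a, b) ⟨ht, Metric.mem_closedBall_self zero_le_one, ha, hb⟩ (by
      simp only [Prod.dist_eq, dist_self, max_lt_iff]
      exact ⟨hst.trans_le (min_le_left _ _), hx.trans_le (min_le_left _ _), hδ⟩)
  have h2 : l (f t x a b) ≤ c := hl _ (subset_convexHull ℝ _ ⟨a, ha, b, hb, rfl⟩)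
  have h3 := (abs_lt.1 (Real.dist_eq _ _ ▸ h1)).2
  simp only [Function.comp_apply] at h3
  show l (f s x' a b) ≤ c + ε
  linarith

lemma norm_le_of_mem_velSet {C : ℝ} {t : ℝ} {x v : EuclideanSpace ℝ (Fin n)}
    (hC : ∀ u ∈ P, ∀ v ∈ Q, ‖f t x u v‖ ≤ C * (1 + ‖x‖)) (hv : v ∈ velSet f P Q t x) :
    ‖v‖ ≤ C * (1 + ‖x‖) := by
  refine mem_closedBall_zero_iff.1 (convexHull_min ?_ (convex_closedBall 0 _) hv)
  rintro _ ⟨a, ha, b, hb, rfl⟩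
  exact mem_closedBall_zero_iff.2 (hC a ha b hb)

end velSet

/-- Solutions of a differential inclusion of linear growth with initial states in a bounded set
are equibounded and equi-Lipschitz. -/
lemma exists_uniform_bound_of_growth {n : ℕ} {t₀ θ₀ C : ℝ}
    {F : ℝ → EuclideanSpace ℝ (Fin n) → Set (EuclideanSpace ℝ (Fin n))} (hC : 0 ≤ C)
    (hF : ∀ t ∈ Icc t₀ θ₀, ∀ x, ∀ v ∈ F t x, ‖v‖ ≤ C * (1 + ‖x‖)) (ρ : ℝ) :
    ∃ (R : ℝ) (M : NNReal), ∀ a ∈ Icc t₀ θ₀, ∀ x y, ‖x‖ ≤ ρ → IsSol F θ₀ a x y →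
      (∀ t ∈ Icc a θ₀, ‖y t‖ ≤ R) ∧ LipschitzOnWith M y (Icc a θ₀) := by
  set R := (1 + ρ ^ 2) * Real.exp (4 * C * (θ₀ - t₀)) with hR
  have hR0 : 0 ≤ R := by positivity
  refine ⟨R, ⟨C * (1 + R), by positivity⟩, fun a ha x y hx ⟨⟨K, hK⟩, hya, hsol⟩ => ?_⟩
  have hbound : ∀ t ∈ Icc a θ₀, ‖y t‖ ≤ R := by
    intro t ht
    have hsub : Icc a t ⊆ Icc a θ₀ := Icc_subset_Icc_right ht.2
    refine (norm_le_of_ae_hasDerivAt_growth hC ht.1 (hK.mono hsub) ?_).trans ?_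
    · filter_upwards [ae_restrict_of_ae_restrict_of_subset hsub hsol,
        ae_restrict_mem measurableSet_Icc] with s ⟨v, hv, hd⟩ hs
      exact ⟨v, hF s ⟨ha.1.trans hs.1, hs.2.trans ht.2⟩ _ v hv, hd⟩
    · rw [hya, hR]
      have := ht.2
      have := ha.1
      gcongr
  refine ⟨hbound, LipschitzOnWith.of_dist_le_mul fun s hs t ht => ?_⟩
  have hordered : ∀ s ∈ Icc a θ₀, ∀ t ∈ Icc a θ₀, s ≤ t →
      ‖y t - y s‖ ≤ C * (1 + R) * (t - s) := by
    intro s hs t ht hst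
    have hsub : Icc s t ⊆ Icc a θ₀ := Icc_subset_Icc hs.1 ht.2
    refine norm_sub_le_of_ae_hasDerivAt hst (hK.mono hsub) ?_
    filter_upwards [ae_restrict_of_ae_restrict_of_subset hsub hsol,
      ae_restrict_mem measurableSet_Icc] with r ⟨v, hv, hd⟩ hr
    have hr' := hsub hr
    refine ⟨v, (hF r ⟨ha.1.trans hr'.1, hr'.2⟩ _ v hv).trans ?_, hd⟩
    have := hbound r hr'
    gcongr
  show dist (y s) (y t) ≤ C * (1 + R) * dist s t
  rcases le_total s t with hst | hst
  · rw [dist_comm, dist_comm s, dist_eq_norm, Real.dist_eq, abs_of_nonneg (sub_nonneg.2 hst)]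
    exact hordered s hs t ht hst
  · rw [dist_eq_norm, Real.dist_eq, abs_of_nonneg (sub_nonneg.2 hst)]
    exact hordered t ht s hs hst

lemma mem_graphClosure_iff {n : ℕ} {t₀ θ₀ : ℝ}
    {T : ℝ → EuclideanSpace ℝ (Fin n) → Set (ℝ × ℝ)} {t : ℝ} {x : EuclideanSpace ℝ (Fin n)}
    {J : ℝ × ℝ} :
    J ∈ graphClosure t₀ θ₀ T t x ↔
      (t, x, J) ∈ closure {z : ℝ × EuclideanSpace ℝ (Fin n) × (ℝ × ℝ) |
        z.1 ∈ Icc t₀ θ₀ ∧ z.2.2 ∈ T z.1 z.2.1} := by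
  rw [mem_closure_iff_seq_limit]
  constructor
  · rintro ⟨ts, xs, zs, hts, hzs, h1, h2, h3⟩
    exact ⟨fun k => (ts k, xs k, zs k), fun k => ⟨hts k, hzs k⟩,
      h1.prodMk_nhds (h2.prodMk_nhds h3)⟩
  · rintro ⟨z, hz, hlim⟩
    exact ⟨fun k => (z k).1, fun k => (z k).2.1, fun k => (z k).2.2, fun k => (hz k).1,
      fun k => (hz k).2, (continuous_fst.tendsto _).comp hlim,
      ((continuous_fst.comp continuous_snd).tendsto _).comp hlim,
      ((continuous_snd.comp continuous_snd).tendsto _).comp hlim⟩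

/-- Condition (N3) passes to the graph-closure. -/
lemma CondN3.graphClosure {n : ℕ} {t₀ θ₀ C : ℝ}
    {F : ℝ → EuclideanSpace ℝ (Fin n) → Set (EuclideanSpace ℝ (Fin n))} (hC : 0 ≤ C)
    (hF : ∀ t ∈ Icc t₀ θ₀, ∀ x, ∀ v ∈ F t x, ‖v‖ ≤ C * (1 + ‖x‖))
    (husc : ScalarUpperSemicontinuous t₀ θ₀ F)
    (hclosed : ∀ t ∈ Icc t₀ θ₀, ∀ x, IsClosed (F t x)) (hconv : ∀ t x, Convex ℝ (F t x))
    {T : ℝ → EuclideanSpace ℝ (Fin n) → Set (ℝ × ℝ)} (hT : CondN3 t₀ θ₀ F T) :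
    CondN3 t₀ θ₀ F (_root_.graphClosure t₀ θ₀ T) := by
  intro tstar htstar xstar J hJ
  obtain ⟨ts, xs, zs, hts, hzs, htlim, hxlim, hzlim⟩ := id hJ
  choose y hsol hmem using fun k => hT (ts k) (hts k) (xs k) (zs k) (hzs k)
  obtain ⟨ρ, hρ⟩ := hxlim.norm.bddAbove_range
  obtain ⟨R, M, hRM⟩ := exists_uniform_bound_of_growth hC hF ρ
  have hbd := fun k => hRM (ts k) (hts k) (xs k) (y k) (hρ ⟨k, rfl⟩) (hsol k)
  let Y : ℕ → ℝ → EuclideanSpace ℝ (Fin n) := fun k =>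
    IccExtend (hts k).2 ((Icc (ts k) θ₀).domRestrict (y k))
  have hYeq : ∀ k, ∀ s ∈ Icc (ts k) θ₀, Y k s = y k s := fun k s hs =>
    IccExtend_of_mem (hts k).2 _ hs
  have hYlip : ∀ k, LipschitzWith M (Y k) := fun k => by
    have h := (hbd k).2.to_restrict.comp (LipschitzWith.projIcc (hts k).2)
    rwa [mul_one] at h
  have hYbd : ∀ k s, Y k s ∈ Metric.closedBall (0 : EuclideanSpace ℝ (Fin n)) R := fun k s =>
    mem_closedBall_zero_iff.2 ((hbd k).1 _ (projIcc (ts k) θ₀ (hts k).2 s).2)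
  let U : Ultrafilter ℕ := hyperfilter ℕ
  have hU : (U : Filter ℕ) ≤ atTop := Nat.hyperfilter_le_atTop
  have hex : ∀ s, ∃ z, Tendsto (fun k => Y k s) U (𝓝 z) := fun s => by
    obtain ⟨z, -, hz⟩ := (isCompact_closedBall (0 : EuclideanSpace ℝ (Fin n)) R).ultrafilter_le_nhds
      (U.map fun k => Y k s) (by
        rw [Ultrafilter.coe_map]
        exact tendsto_principal.2 (Eventually.of_forall fun k => hYbd k s))
    exact ⟨z, hz⟩
  choose ylim hlim using hex
  have hlip : LipschitzWith M ylim := LipschitzWith.of_dist_le_mul fun s t =>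
    le_of_tendsto ((hlim s).dist (hlim t)) (Eventually.of_forall fun k => (hYlip k).dist_le_mul s t)
  have hinit : ylim tstar = xstar := by
    refine tendsto_nhds_unique (hlim tstar)
      ((?_ : Tendsto (fun k => Y k tstar) atTop _).mono_left hU)
    rw [tendsto_iff_dist_tendsto_zero]
    have hub : Tendsto (fun k => M * dist tstar (ts k) + dist (xs k) xstar) atTop (𝓝 0) := by
      simpa using (((tendsto_const_nhds (x := tstar)).dist htlim).const_mul (M : ℝ)).add
        (tendsto_iff_dist_tendsto_zero.1 hxlim)
    refine squeeze_zero (fun _ => dist_nonneg) (fun k => ?_) hub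
    have h1 := (hYlip k).dist_le_mul tstar (ts k)
    rw [hYeq k (ts k) ⟨le_rfl, (hts k).2⟩, (hsol k).2.1] at h1
    exact (dist_triangle _ (xs k) _).trans (by gcongr)
  have hlate : ∀ t, tstar < t → ∀ᶠ k in (U : Filter ℕ), ts k < t := fun t ht =>
    hU (htlim.eventually (Iio_mem_nhds ht))
  refine ⟨ylim, ⟨⟨M, hlip.lipschitzOnWith⟩, hinit, ?_⟩, fun t ht => ?_⟩
  · rw [← restrict_Ioo_eq_restrict_Icc]
    filter_upwards [ae_restrict_of_ae hlip.ae_differentiableAt_real,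
      ae_restrict_mem measurableSet_Ioo] with t hd ht
    have ht' : t ∈ Icc t₀ θ₀ := ⟨htstar.1.trans ht.1.le, ht.2.le⟩
    refine ⟨deriv ylim t, ?_, hd.hasDerivAt⟩
    refine husc.mem_of_hasDerivAt_limit (U := U) hYlip hlim ⟨ht'.1, ht.2⟩ (hclosed t ht' _)
      (hconv _ _) ?_ hd.hasDerivAt
    filter_upwards [hlate t ht.1] with k hk
    have hk' := ae_restrict_of_ae_restrict_of_subset (Icc_subset_Icc_left hk.le) (hsol k).2.2
    rw [← restrict_Ioo_eq_restrict_Icc] at hk' ⊢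
    filter_upwards [hk', ae_restrict_mem measurableSet_Ioo] with s ⟨w, hw, hws⟩ hs
    have hmemIcc : Icc (ts k) θ₀ ∈ 𝓝 s := Icc_mem_nhds (hk.trans hs.1) hs.2
    refine ⟨w, ?_, hws.congr_of_eventuallyEq ?_⟩
    · rwa [hYeq k s (mem_of_mem_nhds hmemIcc)]
    · filter_upwards [hmemIcc] with r hr using hYeq k r hr
  · rcases ht.1.eq_or_lt with rfl | hlt
    · rwa [hinit]
    rw [mem_graphClosure_iff]
    refine mem_closure_of_tendsto
      (tendsto_const_nhds.prodMk_nhds ((hlim t).prodMk_nhds (hzlim.mono_left hU))) ?_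
    filter_upwards [hlate t hlt] with k hk
    refine ⟨⟨htstar.1.trans ht.1, ht.2⟩, ?_⟩
    show zs k ∈ T t (Y k t)
    rw [hYeq k t ⟨hk.le, ht.2⟩]
    exact hmem k t ⟨hk.le, ht.2⟩

lemma CondN3.iUnion {n : ℕ} {t₀ θ₀ : ℝ}
    {F : ℝ → EuclideanSpace ℝ (Fin n) → Set (EuclideanSpace ℝ (Fin n))} {I : Type*}
    {T : I → ℝ → EuclideanSpace ℝ (Fin n) → Set (ℝ × ℝ)} (hT : ∀ i, CondN3 t₀ θ₀ F (T i)) :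
    CondN3 t₀ θ₀ F fun t x => ⋃ i, T i t x := by
  intro t ht x J hJ
  obtain ⟨i, hi⟩ := mem_iUnion.1 hJ
  obtain ⟨y, hy, hmem⟩ := hT i t ht x J hi
  exact ⟨y, hy, fun s hs => mem_iUnion.2 ⟨i, hmem s hs⟩⟩

/-- If every member of a family `{T^α}` of multivalued maps satisfies condition (N3),
then the graph-closure `T*` of the pointwise union `T = ⋃_α T^α` has closed graph and
satisfies condition (N3). -/
theorem graphClosure_of_union_satisfies_N3
    {n p q : ℕ} (t₀ θ₀ : ℝ) (ht : t₀ < θ₀)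
    (P : Set (EuclideanSpace ℝ (Fin p))) (Q : Set (EuclideanSpace ℝ (Fin q)))
    (hPne : P.Nonempty) (hPc : IsCompact P) (hQne : Q.Nonempty) (hQc : IsCompact Q)
    (f : ℝ → EuclideanSpace ℝ (Fin n) → EuclideanSpace ℝ (Fin p) → EuclideanSpace ℝ (Fin q) →
      EuclideanSpace ℝ (Fin n))
    (hf_cont : ContinuousOn
      (fun z : ℝ × EuclideanSpace ℝ (Fin n) × EuclideanSpace ℝ (Fin p) × EuclideanSpace ℝ (Fin q) =>
        f z.1 z.2.1 z.2.2.1 z.2.2.2)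
      (Icc t₀ θ₀ ×ˢ (univ : Set (EuclideanSpace ℝ (Fin n))) ×ˢ P ×ˢ Q))
    (hf_lip : ∃ L : ℝ, ∀ t ∈ Icc t₀ θ₀, ∀ u ∈ P, ∀ v ∈ Q,
      ∀ x x' : EuclideanSpace ℝ (Fin n), ‖f t x u v - f t x' u v‖ ≤ L * ‖x - x'‖)
    (hf_growth : ∃ C : ℝ, ∀ t ∈ Icc t₀ θ₀, ∀ u ∈ P, ∀ v ∈ Q,
      ∀ x : EuclideanSpace ℝ (Fin n), ‖f t x u v‖ ≤ C * (1 + ‖x‖))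
    {I : Type*} (Tfam : I → ℝ → EuclideanSpace ℝ (Fin n) → Set (ℝ × ℝ))
    (hfam : ∀ α : I, CondN3 t₀ θ₀ (velSet f P Q) (Tfam α)) :
    IsClosed {z : ℝ × EuclideanSpace ℝ (Fin n) × (ℝ × ℝ) |
        z.2.2 ∈ graphClosure t₀ θ₀ (fun t x => ⋃ α : I, Tfam α t x) z.1 z.2.1} ∧
      CondN3 t₀ θ₀ (velSet f P Q)
        (graphClosure t₀ θ₀ (fun t x => ⋃ α : I, Tfam α t x)) := by
  constructor
  · simp_rw [mem_graphClosure_iff]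
    exact isClosed_closure
  · obtain ⟨C, hC⟩ := hf_growth
    refine (CondN3.iUnion hfam).graphClosure (le_max_right C 0) (fun t ht x v hv => ?_)
      (scalarUpperSemicontinuous_velSet hPc hQc hf_cont)
      (fun t ht x => isClosed_velSet hPc hQc hf_cont ht x) fun t x => convex_convexHull ℝ _
    refine norm_le_of_mem_velSet (fun u hu v hv => (hC t ht u hu v hv x).trans ?_) hv
    gcongr
    exact le_max_left C 0
end
end

section
/- Define φ₁ : ℝ×ℝ² → ℝ by φ₁(t,x,y) := x−y if x ≤ y; φ₁(t,x,y) := −x+y+2(1−t) if x > y and −x+y+2(1−t) < 0; and φ₁(t,x,y) := 0 if x > y and −x+y+2(1−t) ≥ 0. Then: (a) φ₁(1,x,y) = −|x−y| for all x,y ∈ ℝ; (b) for every t ∈ (0,1) and x,y ∈ ℝ, every (a,s_x,s_y) ∈ D⁺φ₁(t,x,y) satisfies a + |s_x| + s_y ≤ 0, and every (a,s_x,s_y) ∈ D⁻φ₁(t,x,y) satisfies a + |s_x| + s_y ≥ 0. -/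
open Set Filter
open scoped Topology

noncomputable section

/-- Euclidean inner product on `ℝ³ = ℝ × ℝ × ℝ`. -/
def dot3 (p z : ℝ × ℝ × ℝ) : ℝ := p.1 * z.1 + p.2.1 * z.2.1 + p.2.2 * z.2.2

/-- The Fréchet superdifferential of `φ : ℝ³ → ℝ` at `z`. -/
def superDiff (φ : ℝ × ℝ × ℝ → ℝ) (z : ℝ × ℝ × ℝ) : Set (ℝ × ℝ × ℝ) :=
  {p | Filter.limsup
      (fun z' : ℝ × ℝ × ℝ => ((φ z' - φ z - dot3 p (z' - z)) / ‖z' - z‖ : EReal))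
      (𝓝[≠] z) ≤ 0}

/-- The Fréchet subdifferential of `φ : ℝ³ → ℝ` at `z`. -/
def subDiff (φ : ℝ × ℝ × ℝ → ℝ) (z : ℝ × ℝ × ℝ) : Set (ℝ × ℝ × ℝ) :=
  {p | (0 : EReal) ≤ Filter.liminf
      (fun z' : ℝ × ℝ × ℝ => ((φ z' - φ z - dot3 p (z' - z)) / ‖z' - z‖ : EReal))
      (𝓝[≠] z)}

/-- `φ₁(t,x,y)`: the minimax solution of `∂φ/∂t + |∂φ/∂x| + ∂φ/∂y = 0`,
`φ(1,x,y) = -|x-y|`; the argument is `z = (t,x,y)`. -/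
def phi1 (z : ℝ × ℝ × ℝ) : ℝ :=
  if z.2.1 ≤ z.2.2 then z.2.1 - z.2.2
  else if -z.2.1 + z.2.2 + 2 * (1 - z.1) < 0 then -z.2.1 + z.2.2 + 2 * (1 - z.1)
  else 0

lemma tendsto_add_smul_nhdsNE {E : Type*} [NormedAddCommGroup E] [NormedSpace ℝ E] (z : E)
    {v : E} (hv : v ≠ 0) :
    Tendsto (fun h : ℝ => z + h • v) (𝓝[>] 0) (𝓝[≠] z) := by
  refine tendsto_nhdsWithin_iff.2 ⟨?_, ?_⟩
  · have hc : Continuous fun h : ℝ => z + h • v := by fun_prop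
    have := hc.tendsto 0
    simp only [zero_smul, add_zero] at this
    exact this.mono_left nhdsWithin_le_nhds
  · filter_upwards [self_mem_nhdsWithin] with h hh
    have hh' : h ≠ 0 := ne_of_gt hh
    simp [hh', hv]

lemma dot3_smul (p v : ℝ × ℝ × ℝ) (h : ℝ) : dot3 p (h • v) = h * dot3 p v := by
  simp only [dot3, Prod.smul_fst, Prod.smul_snd, smul_eq_mul]
  ring

lemma difference_quotient_add_smul (φ : ℝ × ℝ × ℝ → ℝ) (z p v : ℝ × ℝ × ℝ) {h : ℝ} (hh : 0 < h) :
    (((φ (z + h • v) : ℝ) - (φ z : ℝ) - (dot3 p (z + h • v - z) : ℝ)) /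
      (‖z + h • v - z‖ : ℝ) : EReal) =
      (((φ (z + h • v) - φ z) / (h * ‖v‖) - dot3 p v / ‖v‖ : ℝ) : EReal) := by
  rw [← EReal.coe_sub, ← EReal.coe_sub, ← EReal.coe_div, add_sub_cancel_left, dot3_smul,
    norm_smul, Real.norm_of_nonneg hh.le, sub_div, mul_div_mul_left _ _ hh.ne']

/-- A supergradient is nonnegative in every direction along which `φ` does not decrease. -/
lemma dot3_nonneg_of_mem_superDiff {φ : ℝ × ℝ × ℝ → ℝ} {z p v : ℝ × ℝ × ℝ}
    (hp : p ∈ superDiff φ z) (hv : v ≠ 0) (hφ : ∀ h : ℝ, 0 < h → φ z ≤ φ (z + h • v)) :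
    0 ≤ dot3 p v := by
  have hle : ((-(dot3 p v / ‖v‖) : ℝ) : EReal) ≤ 0 := by
    refine le_trans ?_ hp
    refine le_limsup_of_frequently_le' ((tendsto_add_smul_nhdsNE z hv).frequently
      (Eventually.frequently ?_))
    filter_upwards [self_mem_nhdsWithin] with h hh
    rw [difference_quotient_add_smul φ z p v hh, EReal.coe_le_coe_iff]
    have : 0 ≤ (φ (z + h • v) - φ z) / (h * ‖v‖) :=
      div_nonneg (sub_nonneg.2 (hφ h hh)) (mul_nonneg (le_of_lt hh) (norm_nonneg v))
    linarith
  have hq : 0 ≤ dot3 p v / ‖v‖ := by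
    have : -(dot3 p v / ‖v‖) ≤ 0 := by exact_mod_cast hle
    linarith
  simpa [div_mul_cancel₀ _ (norm_ne_zero_iff.2 hv)] using mul_nonneg hq (norm_nonneg v)

/-- A subgradient is nonpositive in every direction along which `φ` does not increase. -/
lemma dot3_nonpos_of_mem_subDiff {φ : ℝ × ℝ × ℝ → ℝ} {z p v : ℝ × ℝ × ℝ}
    (hp : p ∈ subDiff φ z) (hv : v ≠ 0) (hφ : ∀ h : ℝ, 0 < h → φ (z + h • v) ≤ φ z) :
    dot3 p v ≤ 0 := by
  have hle : (0 : EReal) ≤ ((-(dot3 p v / ‖v‖) : ℝ) : EReal) := by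
    refine le_trans hp ?_
    refine liminf_le_of_frequently_le' ((tendsto_add_smul_nhdsNE z hv).frequently
      (Eventually.frequently ?_))
    filter_upwards [self_mem_nhdsWithin] with h hh
    rw [difference_quotient_add_smul φ z p v hh, EReal.coe_le_coe_iff]
    have : (φ (z + h • v) - φ z) / (h * ‖v‖) ≤ 0 :=
      div_nonpos_of_nonpos_of_nonneg (sub_nonpos.2 (hφ h hh))
        (mul_nonneg (le_of_lt hh) (norm_nonneg v))
    linarith
  have hq : dot3 p v / ‖v‖ ≤ 0 := by
    have : 0 ≤ -(dot3 p v / ‖v‖) := by exact_mod_cast hle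
    linarith
  simpa [div_mul_cancel₀ _ (norm_ne_zero_iff.2 hv)] using
    mul_nonpos_of_nonpos_of_nonneg hq (norm_nonneg v)

lemma phi1_le_add_smul {t x y ε h : ℝ} (hε : |ε| ≤ 1) (ht : t < 1) (hh : 0 < h) :
    phi1 (t, x, y) ≤ phi1 ((t, x, y) + h • (-1, -ε, -1)) := by
  obtain ⟨h₁, h₂⟩ := abs_le.1 hε
  have h₃ : h * ε ≤ h := by nlinarith
  have h₄ : -h ≤ h * ε := by nlinarith
  simp only [phi1, Prod.smul_mk, Prod.mk_add_mk, smul_eq_mul, mul_neg, mul_one]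
  split_ifs <;> linarith

lemma exists_phi1_add_smul_le (t x y : ℝ) :
    ∃ ε : ℝ, |ε| ≤ 1 ∧
      ∀ h : ℝ, 0 < h → phi1 ((t, x, y) + h • (-1, -ε, -1)) ≤ phi1 (t, x, y) := by
  by_cases hxy : x ≤ y
  · refine ⟨1, by simp, fun h hh => ?_⟩
    simp only [phi1, Prod.smul_mk, Prod.mk_add_mk, smul_eq_mul, mul_neg, mul_one]
    split_ifs <;> linarith
  · refine ⟨-1, by simp, fun h hh => ?_⟩
    simp only [phi1, Prod.smul_mk, Prod.mk_add_mk, smul_eq_mul, mul_neg, mul_one]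
    split_ifs <;> linarith

/-- `φ₁` satisfies the terminal condition `φ₁(1,x,y) = -|x-y|` and is a viscosity (minimax)
solution of the Hamilton–Jacobi equation `∂φ/∂t + |∂φ/∂x| + ∂φ/∂y = 0` on `(0,1)×ℝ²`:
superdifferential elements satisfy `a + |s_x| + s_y ≤ 0` and subdifferential elements
satisfy `a + |s_x| + s_y ≥ 0`. -/
theorem phi1_minimax_solution :
    (∀ x y : ℝ, phi1 (1, x, y) = -|x - y|) ∧
    (∀ t ∈ Ioo (0 : ℝ) 1, ∀ x y : ℝ,
      (∀ a sx sy : ℝ, (a, sx, sy) ∈ superDiff phi1 (t, x, y) → a + |sx| + sy ≤ 0) ∧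
      (∀ a sx sy : ℝ, (a, sx, sy) ∈ subDiff phi1 (t, x, y) → a + |sx| + sy ≥ 0)) := by
  refine ⟨fun x y => ?_, fun t ht x y => ⟨fun a sx sy hp => ?_, fun a sx sy hp => ?_⟩⟩
  · rcases le_or_gt x y with hxy | hxy
    · rw [abs_of_nonpos (sub_nonpos.2 hxy)]
      simp [phi1, hxy]
    · rw [abs_of_pos (sub_pos.2 hxy)]
      simp only [phi1]
      split_ifs <;> linarith
  · obtain ⟨ε, hε, hsx⟩ : ∃ ε : ℝ, |ε| ≤ 1 ∧ ε * sx = |sx| := by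
      rcases abs_cases sx with ⟨hs, _⟩ | ⟨hs, _⟩
      · exact ⟨1, by simp, by rw [hs, one_mul]⟩
      · exact ⟨-1, by simp, by rw [hs, neg_one_mul]⟩
    have := dot3_nonneg_of_mem_superDiff (v := (-1, -ε, -1)) hp (by simp)
      fun h hh => phi1_le_add_smul hε ht.2 hh
    simp only [dot3] at this
    linarith
  · obtain ⟨ε, hε, hφ⟩ := exists_phi1_add_smul_le t x y
    have := dot3_nonpos_of_mem_subDiff (v := (-1, -ε, -1)) hp (by simp) hφ
    have hsx : ε * sx ≤ |sx| := by
      calc ε * sx ≤ |ε * sx| := le_abs_self _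
        _ = |ε| * |sx| := abs_mul _ _
        _ ≤ |sx| := mul_le_of_le_one_left (abs_nonneg _) hε
    simp only [dot3] at this
    linarith
end
end
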